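/- Let M be an internally 4-connected binary matroid in which every element is in exactly three triangles and whose ground set has at least 14 elements. Let e be an element of M and let T_1, T_2, T_3 be the three triangles of M containing e. If (T_1 ∪ T_2 ∪ T_3) − e is a cocircuit C* of M, then si(M/x) is internally 4-connected for every element x of C*. -/

import Mathlib

open Set Matroid

namespace Paper

variable {α : Type*}

/-- A circuit of a matroid: a minimal dependent set. -/
def Circuit (M : Matroid α) (C : Set α) : Prop :=
  C ⊆ M.E ∧ ¬ M.Indep C ∧ ∀ D, D ⊂ C → M.Indep D

/-- A cocircuit: a circuit of the dual matroid. -/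
def Cocircuit (M : Matroid α) (C : Set α) : Prop := Circuit M✶ C

/-- A triangle: a 3-element circuit. -/
def IsTriangle (M : Matroid α) (T : Set α) : Prop := Circuit M T ∧ T.encard = 3

/-- A triad: a 3-element cocircuit. -/
def IsTriad (M : Matroid α) (T : Set α) : Prop := Cocircuit M T ∧ T.encard = 3

/-- The (extended) rank of a set: the supremum of the cardinalities of
independent subsets. -/
noncomputable def eRank (M : Matroid α) (X : Set α) : ℕ∞ :=
  ⨆ I ∈ {I : Set α | M.Indep I ∧ I ⊆ X}, I.encard

/-- The rank of the matroid. -/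
noncomputable def eRk (M : Matroid α) : ℕ∞ := eRank M M.E

/-- `(X, Y)` is a `k`-separation of `M`: a partition of the ground set into
two sets, each of size at least `k`, with `λ(X) = r(X) + r(Y) - r(M) ≤ k - 1`. -/
def IsKSeparation (M : Matroid α) (k : ℕ) (X Y : Set α) : Prop :=
  Disjoint X Y ∧ X ∪ Y = M.E ∧
    eRank M X + eRank M Y ≤ eRk M + ((k - 1 : ℕ) : ℕ∞) ∧
    (k : ℕ∞) ≤ X.encard ∧ (k : ℕ∞) ≤ Y.encard

/-- `M` is `n`-connected if it has no `k`-separation for any positive `k < n`. -/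
def NConnected (M : Matroid α) (n : ℕ) : Prop :=
  ∀ k, 1 ≤ k → k < n → ∀ X Y, ¬ IsKSeparation M k X Y

/-- `M` is internally 4-connected if it is 3-connected and every
3-separation has a side that is a triangle or a triad. -/
def InternallyFourConnected (M : Matroid α) : Prop :=
  NConnected M 3 ∧ ∀ X Y, IsKSeparation M 3 X Y →
    IsTriangle M X ∨ IsTriad M X ∨ IsTriangle M Y ∨ IsTriad M Y

/-- `M` is binary: representable over `GF(2)`. -/
def Binary (M : Matroid α) : Prop :=
  ∃ φ : α → (α →₀ ZMod 2), ∀ I, I ⊆ M.E →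
    (M.Indep I ↔ LinearIndependent (ZMod 2) (fun x : I => φ x.1))

/-- Every element of `M` is in exactly three triangles. -/
def EveryElementInThreeTriangles (M : Matroid α) : Prop :=
  ∀ e ∈ M.E, {T : Set α | IsTriangle M T ∧ e ∈ T}.encard = 3

/-- Deletion of a set of elements. -/
def delete (M : Matroid α) (D : Set α) : Matroid α := M ↾ (M.E \ D)

/-- Contraction of a set of elements. -/
def contract (M : Matroid α) (C : Set α) : Matroid α := (delete M✶ C)✶

/-- A nonloop. -/
def Nonloop (M : Matroid α) (e : α) : Prop := M.Indep {e}

/-- `N` is a simplification of `M`: the restriction of `M` to a set of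
nonloops containing exactly one element from each parallel class. -/
def IsSimplificationOf (N M : Matroid α) : Prop :=
  ∃ S, S ⊆ M.E ∧ N = M ↾ S ∧ (∀ e ∈ S, Nonloop M e) ∧
    ∀ f, Nonloop M f → ∃! e, e ∈ S ∧ M.closure {e} = M.closure {f}

/-- `si(M/e)` is internally 4-connected. -/
def SiContractI4C (M : Matroid α) (e : α) : Prop :=
  ∀ N, IsSimplificationOf N (contract M {e}) → InternallyFourConnected N

/-- A set is fully closed if it is closed in `M` and in `M✶`. -/
def FullyClosed (M : Matroid α) (F : Set α) : Prop :=
  M.closure F = F ∧ M✶.closure F = F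

/-- The full closure of a set: the intersection of all fully closed sets
containing it. -/
def fcl (M : Matroid α) (Z : Set α) : Set α := ⋂₀ {F | Z ⊆ F ∧ FullyClosed M F}

/-- An exact 4-separation: a 4-separation with `λ = 3`. -/
def IsExact4Separation (M : Matroid α) (X Y : Set α) : Prop :=
  Disjoint X Y ∧ X ∪ Y = M.E ∧
    eRank M X + eRank M Y = eRk M + 3 ∧
    (4 : ℕ∞) ≤ X.encard ∧ (4 : ℕ∞) ≤ Y.encard


lemma eRank_eq (M : Matroid α) (X : Set α) : eRank M X = M.eRk X := by
  apply le_antisymm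
  · exact iSup₂_le fun I hI => hI.1.encard_le_eRk_of_subset hI.2
  · obtain ⟨I, hI⟩ := M.exists_isBasis' X
    rw [← hI.encard_eq_eRk]
    exact le_iSup₂_of_le I ⟨hI.indep, hI.subset⟩ le_rfl

lemma eRk_eq (M : Matroid α) : eRk M = M.eRank := by
  rw [eRk, eRank_eq, Matroid.eRk_ground]

lemma exists_rho (M : Matroid α) (h : M.eRank ≠ ⊤) : ∃ ρ : Set α → ℕ, ∀ X, M.eRk X = ρ X := by
  have : ∀ X, ∃ n : ℕ, M.eRk X = n := fun X =>
    ENat.ne_top_iff_exists.1 (ne_top_of_le_ne_top h (M.eRk_le_eRank X)) |>.imp fun _ h => h.symm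
  choose ρ hρ using this
  exact ⟨ρ, hρ⟩

lemma kSep_of (M : Matroid α) (k : ℕ) (X : Set α) (hX : X ⊆ M.E)
    (h : M.eRk X + M.eRk (M.E \ X) ≤ M.eRank + ((k - 1 : ℕ) : ℕ∞))
    (h1 : (k : ℕ∞) ≤ X.encard) (h2 : (k : ℕ∞) ≤ (M.E \ X).encard) :
    IsKSeparation M k X (M.E \ X) := by
  refine ⟨disjoint_sdiff_right, by simp [hX], ?_, h1, h2⟩
  rwa [eRank_eq, eRank_eq, eRk_eq]

lemma rank_fin {M : Matroid α} (h : NConnected M 3) (hE : (14 : ℕ∞) ≤ M.E.encard) :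
    M.eRank ≠ ⊤ := by
  intro ht
  have hne : M.E.Nonempty := by
    rw [← Set.encard_ne_zero]; intro h0; rw [h0] at hE; norm_num at hE
  obtain ⟨x, hx⟩ := hne
  refine h 1 le_rfl (by norm_num) {x} (M.E \ {x}) (kSep_of M 1 {x} (by simpa) (by simp [ht]) (by simp) ?_)
  have := Set.encard_sdiff_add_encard_of_subset (s := {x}) (t := M.E) (by simpa)
  rw [← this, Set.encard_singleton] at hE
  by_contra hc
  have : (M.E \ {x}).encard = 0 := by
    rw [Set.encard_eq_zero, ← Set.not_nonempty_iff_eq_empty]; simpa using hc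
  rw [this] at hE; norm_num at hE

lemma conn {M : Matroid α} (h : NConnected M 3) (hf : M.eRank ≠ ⊤) (k : ℕ) (hk1 : 1 ≤ k)
    (hk : k < 3) (X : Set α) (hX : X ⊆ M.E) (h1 : (k : ℕ∞) ≤ X.encard)
    (h2 : (k : ℕ∞) ≤ (M.E \ X).encard) : M.eRank + k ≤ M.eRk X + M.eRk (M.E \ X) := by
  by_contra hc
  refine h k hk1 hk X _ (kSep_of M k X hX ?_ h1 h2)
  obtain ⟨ρ, hρ⟩ := exists_rho M hf
  rw [← Matroid.eRk_ground, hρ, hρ, hρ] at hc ⊢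
  norm_cast at hc ⊢
  omega

lemma conn3 {M : Matroid α} (h : InternallyFourConnected M) (hf : M.eRank ≠ ⊤)
    (X : Set α) (hX : X ⊆ M.E) (h1 : 4 ≤ X.encard)
    (h2 : 4 ≤ (M.E \ X).encard) : M.eRank + 3 ≤ M.eRk X + M.eRk (M.E \ X) := by
  by_contra hc
  have := h.2 X _ (kSep_of M 3 X hX ?_ (le_trans (by norm_num) h1) (le_trans (by norm_num) h2))
  · rcases this with h | h | h | h <;> have h := h.2 <;> simp [h] at h1 h2
    · exact absurd h1 (by decide)
    · exact absurd h1 (by decide)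
    · exact absurd h2 (by decide)
    · exact absurd h2 (by decide)
  obtain ⟨ρ, hρ⟩ := exists_rho M hf
  rw [← Matroid.eRk_ground, hρ, hρ, hρ] at hc ⊢
  norm_cast at hc ⊢
  omega

lemma compl_big {M : Matroid α} (hE : (14 : ℕ∞) ≤ M.E.encard) {X : Set α} (hX : X ⊆ M.E)
    (h : X.encard ≤ 10) : 4 ≤ (M.E \ X).encard := by
  have := Set.encard_sdiff_add_encard_of_subset hX
  rw [← this] at hE
  have h2 : X.encard ≠ ⊤ := ne_top_of_le_ne_top (by decide) h
  obtain ⟨n, hn⟩ := ENat.ne_top_iff_exists.1 h2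
  rw [← hn] at hE h
  by_cases ht : (M.E \ X).encard = ⊤
  · simp [ht]
  obtain ⟨m, hm⟩ := ENat.ne_top_iff_exists.1 ht
  rw [← hm] at hE ⊢
  norm_cast at *
  omega

lemma simple {M : Matroid α} (h : NConnected M 3) (hE : (14 : ℕ∞) ≤ M.E.encard)
    {u v : α} (hu : u ∈ M.E) (hv : v ∈ M.E) (huv : u ≠ v) : M.Indep {u, v} := by
  have hf := rank_fin h hE
  have hs : ({u, v} : Set α) ⊆ M.E := by simp [Set.insert_subset_iff, hu, hv]
  have hc : ({u, v} : Set α).encard = 2 := Set.encard_pair huv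
  have := conn h hf 2 (by norm_num) (by norm_num) {u, v} hs (by simp [hc])
    (le_trans (by norm_num) (compl_big hE hs (by rw [hc]; norm_num)))
  rw [Matroid.indep_iff_eRk_eq_encard_of_finite (by simp)]
  have h1 := M.eRk_le_eRank (M.E \ {u, v})
  have h2 := M.eRk_le_encard {u, v}
  obtain ⟨ρ, hρ⟩ := exists_rho M hf
  rw [hc] at h2 ⊢
  rw [← Matroid.eRk_ground, hρ] at *
  simp only [hρ] at *
  norm_cast at *
  omega

section rep
variable {M : Matroid α} {φ : α → (α →₀ ZMod 2)} 

lemma mem_cl (hφ : ∀ I, I ⊆ M.E →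
    (M.Indep I ↔ LinearIndependent (ZMod 2) (fun x : I => φ x.1)))
    {X : Set α} (hX : X ⊆ M.E) {f : α} (hf : f ∈ M.E) :
    f ∈ M.closure X ↔ φ f ∈ Submodule.span (ZMod 2) (φ '' X) := by
  have key : ∀ I, M.Indep I → ∀ f ∈ M.E,
      (f ∈ M.closure I ↔ φ f ∈ Submodule.span (ZMod 2) (φ '' I)) := by
    intro I hI f hf
    have hIE := hI.subset_ground
    rw [hI.mem_closure_iff', hφ _ (Set.insert_subset hf hIE)]
    have h1 : LinearIndepOn (ZMod 2) φ I := (hφ I hIE).1 hI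
    have h2 := linearIndepOn_insert_iff (K := ZMod 2) (s := I) (a := f) (f := φ)
    change _ ∧ (LinearIndepOn (ZMod 2) φ (insert f I) → _) ↔ _
    rw [h2]
    have : f ∈ I → φ f ∈ Submodule.span (ZMod 2) (φ '' I) := fun h =>
      Submodule.subset_span (Set.mem_image_of_mem _ h)
    tauto
  obtain ⟨I, hI⟩ := M.exists_isBasis X
  rw [← hI.closure_eq_closure, key I hI.indep f hf]
  have : Submodule.span (ZMod 2) (φ '' I) = Submodule.span (ZMod 2) (φ '' X) := by
    apply le_antisymm
    · exact Submodule.span_mono (Set.image_mono hI.subset)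
    · rw [Submodule.span_le]
      rintro _ ⟨y, hy, rfl⟩
      exact (key I hI.indep y (hX hy)).1 (hI.subset_closure hy)
  rw [this]

lemma dbl (v : α →₀ ZMod 2) : v + v = 0 := ZModModule.add_self v

lemma third {a b c : α →₀ ZMod 2} (h : a + b + c = 0) : c = a + b := by
  have := dbl c
  linear_combination (norm := module) h - dbl a - dbl b

lemma flat_tri (hφ : ∀ I, I ⊆ M.E →
    (M.Indep I ↔ LinearIndependent (ZMod 2) (fun x : I => φ x.1)))
    {A : Set α} (hA : M.closure A = A) {p q r : α} (hp : p ∈ A) (hq : q ∈ A) (hr : r ∈ M.E)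
    (h : φ p + φ q + φ r = 0) : r ∈ A := by
  have hAE : A ⊆ M.E := hA ▸ M.closure_subset_ground A
  rw [← hA, mem_cl hφ hAE hr, third h]
  exact add_mem (Submodule.subset_span (mem_image_of_mem _ hp))
    (Submodule.subset_span (mem_image_of_mem _ hq))

/-- parity of a triple with zero sum in a cocircuit -/
lemma parity (hφ : ∀ I, I ⊆ M.E →
    (M.Indep I ↔ LinearIndependent (ZMod 2) (fun x : I => φ x.1)))
    {K : Set α} (hK : Cocircuit M K) {p q r : α} (hp : p ∈ M.E) (hq : q ∈ M.E) (hr : r ∈ M.E)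
    (h : φ p + φ q + φ r = 0) (hpK : p ∈ K) : (q ∈ K ↔ r ∉ K) := by
  obtain ⟨hKE, hKd, hKm⟩ := hK
  change K ⊆ M.E at hKE
  have hns : ¬ M.Spanning (M.E \ K) := by
    rwa [← Matroid.coindep_iff_compl_spanning hKE]
  have hsp : ∀ k ∈ K, M.closure (insert k (M.E \ K)) = M.E := by
    intro k hk
    have h1 : M.Coindep (K \ {k}) := hKm _ (by simpa using hk)
    have h2 := h1.closure_compl
    refine Eq.trans ?_ h2
    congr 1
    ext y
    have := hKE hk
    simp only [mem_insert_iff, mem_sdiff, mem_singleton_iff]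
    by_cases hy : y = k
    · subst hy; simp [this]
    · simp [hy]
  set W := Submodule.span (ZMod 2) (φ '' (M.E \ K)) with hW
  have hin : ∀ y ∈ M.E, y ∉ K → φ y ∈ W := fun y hy hyK =>
    Submodule.subset_span (mem_image_of_mem _ ⟨hy, hyK⟩)
  have hout : ∀ k ∈ K, φ k ∉ W := by
    intro k hk hkW
    have h1 : k ∈ M.closure (M.E \ K) := (mem_cl hφ sdiff_subset (hKE hk)).2 hkW
    apply hns
    rw [Matroid.spanning_iff_closure_eq sdiff_subset]
    refine Eq.trans ?_ (hsp k hk)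
    rw [Matroid.closure_insert_eq_of_mem_closure h1]
  have hadd : ∀ k ∈ K, ∀ l ∈ K, φ k + φ l ∈ W := by
    intro k hk l hl
    have h1 : k ∈ M.closure (insert l (M.E \ K)) := by rw [hsp l hl]; exact hKE hk
    rw [mem_cl hφ (insert_subset (hKE hl) sdiff_subset) (hKE hk), image_insert_eq,
      Submodule.mem_span_insert] at h1
    obtain ⟨c, w, hw, hc⟩ := h1
    have h01 : ∀ c : ZMod 2, c = 0 ∨ c = 1 := by decide
    have := h01 c
    rcases this with rfl | rfl
    · exact absurd (by rw [hc]; simpa using hw) (hout k hk)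
    · have : φ k + φ l = w := by
        rw [hc, one_smul]
        linear_combination (norm := module) dbl (φ l)
      rw [this]; exact hw
  constructor
  · intro hqK hrK
    exact hout r hrK (third h ▸ hadd p hpK q hqK)
  · intro hrK
    by_contra hqK
    refine hout p hpK ?_
    have : φ p = φ q + φ r := third (by rw [← h]; abel)
    rw [this]
    exact add_mem (hin q hq hqK) (hin r hr hrK)

lemma phi_inj (hφ : ∀ I, I ⊆ M.E →
    (M.Indep I ↔ LinearIndependent (ZMod 2) (fun x : I => φ x.1)))
    (hs : ∀ u ∈ M.E, ∀ v ∈ M.E, u ≠ v → M.Indep {u, v})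
    {u v : α} (hu : u ∈ M.E) (hv : v ∈ M.E) (h : φ u = φ v) : u = v := by
  by_contra hne
  have h1 := hs u hu v hv hne
  have : u ∈ M.closure {v} := by
    rw [mem_cl hφ (by simpa) hu, h]; exact Submodule.subset_span (by simp)
  exact (h1.notMem_closure_sdiff_of_mem (e := u) (by simp)) (by
    refine M.closure_subset_closure ?_ this
    simp [Ne.symm hne])

lemma tri_sum (hφ : ∀ I, I ⊆ M.E →
    (M.Indep I ↔ LinearIndependent (ZMod 2) (fun x : I => φ x.1)))
    {T : Set α} (hT : IsTriangle M T) {p : α} (hp : p ∈ T) :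
    ∃ q r, T = {p, q, r} ∧ p ≠ q ∧ p ≠ r ∧ q ≠ r ∧ φ p + φ q + φ r = 0 ∧
      p ∈ M.E ∧ q ∈ M.E ∧ r ∈ M.E := by
  obtain ⟨⟨hTE, hTd, hTm⟩, hc⟩ := hT
  obtain ⟨a, b, c, hab, hac, hbc, rfl⟩ := Set.encard_eq_three.1 hc
  have main : ∃ q r, ({a, b, c} : Set α) = {p, q, r} ∧ p ≠ q ∧ p ≠ r ∧ q ≠ r := by
    rcases hp with rfl | rfl | rfl
    · exact ⟨b, c, rfl, hab, hac, hbc⟩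
    · exact ⟨a, c, by ext; simp; tauto, hab.symm, hbc, hac⟩
    · exact ⟨a, b, by ext; simp; tauto, hac.symm, hbc.symm, hab⟩
  obtain ⟨q, r, hT, hpq, hpr, hqr⟩ := main
  rw [hT] at hTE hTd hTm
  have hpE : p ∈ M.E := hTE (by simp)
  have hqE : q ∈ M.E := hTE (by simp)
  have hrE : r ∈ M.E := hTE (by simp)
  refine ⟨q, r, hT, hpq, hpr, hqr, ?_, hpE, hqE, hrE⟩
  have e1 : M.Indep {q, r} := hTm _ ⟨by simp, fun h => by
    have : p ∈ ({q, r} : Set α) := h (by simp)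
    simp [hpq, hpr] at this⟩
  have e2 : M.Indep {p, r} := hTm _ ⟨by simp [Set.insert_subset_iff], fun h => by
    have : q ∈ ({p, r} : Set α) := h (by simp)
    simp [hpq.symm, hqr] at this⟩
  have e3 : M.Indep {p, q} := hTm _ ⟨by simp [Set.insert_subset_iff], fun h => by
    have : r ∈ ({p, q} : Set α) := h (by simp)
    simp [hpr.symm, hqr.symm] at this⟩
  have hpcl : p ∈ M.closure {q, r} := by
    rw [e1.mem_closure_iff']
    exact ⟨hpE, fun h => absurd h hTd⟩
  rw [mem_cl hφ (by simp [Set.insert_subset_iff, hqE, hrE]) hpE, image_pair,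
    Submodule.mem_span_pair] at hpcl
  obtain ⟨x, y, hxy⟩ := hpcl
  have h01 : ∀ c : ZMod 2, c = 0 ∨ c = 1 := by decide
  have bad : ∀ {u v : α}, u ≠ v → M.Indep {u, v} → u ∈ M.E → v ∈ M.E →
      φ u ∈ Submodule.span (ZMod 2) (φ '' {v}) → False := by
    intro u v huv hi hu hv h
    rw [← mem_cl hφ (by simpa) hu] at h
    exact (hi.notMem_closure_sdiff_of_mem (e := u) (by simp)) (by
      refine M.closure_subset_closure ?_ h
      simp [Ne.symm huv])
  rcases h01 x with rfl | rfl
  · exfalso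
    refine bad hpr e2 hpE hrE ?_
    rw [image_singleton, Submodule.mem_span_singleton]
    exact ⟨y, by simpa using hxy⟩
  rcases h01 y with rfl | rfl
  · exfalso
    refine bad hpq e3 hpE hqE ?_
    rw [image_singleton, Submodule.mem_span_singleton]
    exact ⟨1, by simpa using hxy⟩
  · simp only [one_smul] at hxy
    rw [← hxy]
    linear_combination (norm := module) dbl (φ q) + dbl (φ r)

lemma tri_of_sum (hφ : ∀ I, I ⊆ M.E →
    (M.Indep I ↔ LinearIndependent (ZMod 2) (fun x : I => φ x.1)))
    (hs : ∀ u ∈ M.E, ∀ v ∈ M.E, u ≠ v → M.Indep {u, v})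
    {p q r : α} (hp : p ∈ M.E) (hq : q ∈ M.E) (hr : r ∈ M.E) (hpq : p ≠ q) (hpr : p ≠ r)
    (hqr : q ≠ r) (h : φ p + φ q + φ r = 0) : IsTriangle M {p, q, r} := by
  have hc : ({p, q, r} : Set α).encard = 3 := Set.encard_eq_three.2 ⟨p, q, r, hpq, hpr, hqr, rfl⟩
  refine ⟨⟨by simp [insert_subset_iff, *], ?_, ?_⟩, hc⟩
  · intro hi
    have h1 : p ∈ M.closure {q, r} := by
      rw [mem_cl hφ (by simp [insert_subset_iff, *]) hp, third (show φ q + φ r + φ p = 0 by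
        rw [← h]; abel)]
      exact add_mem (Submodule.subset_span (by simp)) (Submodule.subset_span (by simp))
    exact (hi.notMem_closure_sdiff_of_mem (e := p) (by simp)) (by
      refine M.closure_subset_closure ?_ h1
      simp [insert_subset_iff, hpq.symm, hpr.symm])
  · intro D hD
    obtain ⟨h1, h2⟩ := hD
    have : ∃ y ∈ ({p, q, r} : Set α), y ∉ D := by
      by_contra hcon; push Not at hcon; exact h2 hcon
    obtain ⟨y, hy, hyD⟩ := this
    have hsub : D ⊆ {p, q, r} \ {y} := fun z hz => ⟨h1 hz, fun h => hyD (h ▸ hz)⟩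
    rcases hy with rfl | rfl | rfl
    · refine (hs q hq r hr hqr).subset (hsub.trans ?_)
      intro z; simp; tauto
    · refine (hs p hp r hr hpr).subset (hsub.trans ?_)
      intro z; simp; tauto
    · refine (hs p hp q hq hpq).subset (hsub.trans ?_)
      intro z; simp; tauto

end rep
lemma prop_aux {xA xB bxA bxB pA pB bpA bpB qA qB bqA bqB eA eB rA rB sA sB zA zB fA fB GA GB : Prop}
    (hxA : xA) (hxB : xB)
    (gA : xA → bxA → pA → bpA → qA → bqA → GA)
    (gB : xB → bxB → pB → bpB → qB → bqB → GB)
    (hA0 : (eA → xA → bxA) ∧ (eA → bxA → xA) ∧ (xA → bxA → eA))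
    (hA1 : (eA → pA → bpA) ∧ (eA → bpA → pA) ∧ (pA → bpA → eA))
    (hA2 : (eA → qA → bqA) ∧ (eA → bqA → qA) ∧ (qA → bqA → eA))
    (hA3 : (xA → pA → rA) ∧ (xA → rA → pA) ∧ (pA → rA → xA))
    (hA4 : (xA → qA → sA) ∧ (xA → sA → qA) ∧ (qA → sA → xA))
    (hA5 : (bxA → bpA → rA) ∧ (bxA → rA → bpA) ∧ (bpA → rA → bxA))
    (hA6 : (bxA → bqA → sA) ∧ (bxA → sA → bqA) ∧ (bqA → sA → bxA))
    (hA7 : (pA → zA → fA) ∧ (pA → fA → zA) ∧ (zA → fA → pA))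
    (hB0 : (eB → xB → bxB) ∧ (eB → bxB → xB) ∧ (xB → bxB → eB))
    (hB1 : (eB → pB → bpB) ∧ (eB → bpB → pB) ∧ (pB → bpB → eB))
    (hB2 : (eB → qB → bqB) ∧ (eB → bqB → qB) ∧ (qB → bqB → eB))
    (hB3 : (xB → pB → rB) ∧ (xB → rB → pB) ∧ (pB → rB → xB))
    (hB4 : (xB → qB → sB) ∧ (xB → sB → qB) ∧ (qB → sB → xB))
    (hB5 : (bxB → bpB → rB) ∧ (bxB → rB → bpB) ∧ (bpB → rB → bxB))
    (hB6 : (bxB → bqB → sB) ∧ (bxB → sB → bqB) ∧ (bqB → sB → bxB))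
    (hB7 : (pB → zB → fB) ∧ (pB → fB → zB) ∧ (zB → fB → pB))
    (ue : eA ∨ eB)
    (up : pA ∨ pB)
    (uq : qA ∨ qB)
    (ubp : bpA ∨ bpB)
    (ubq : bqA ∨ bqB)
    (uf : fA ∨ fB)
    (z1 : zA → qA ∨ bqA) (z2 : zB → qB ∨ bqB) (z3 : qA → bqA → zA) (z4 : qB → bqB → zB) :
    GA ∨ GB := by
  grind

section rep2
variable {M : Matroid α} {φ : α → (α →₀ ZMod 2)}

lemma coc_notin {K : Set α} (hK : Cocircuit M K) {x : α} (hx : x ∈ K) :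
    x ∉ M.closure (M.E \ K) := by
  obtain ⟨hKE, hKd, hKm⟩ := hK
  change K ⊆ M.E at hKE
  intro h1
  apply hKd
  change M.Coindep K
  rw [Matroid.coindep_iff_compl_spanning hKE, Matroid.spanning_iff_closure_eq sdiff_subset]
  have h2 : M.Coindep (K \ {x}) := hKm _ (by simpa using hx)
  refine Eq.trans ?_ h2.closure_compl
  rw [← Matroid.closure_insert_eq_of_mem_closure h1]
  congr 1
  ext y
  have := hKE hx
  simp only [mem_insert_iff, mem_sdiff, mem_singleton_iff]
  by_cases hy : y = x
  · subst hy; simp [this]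
  · simp [hy]

lemma tri_coc (hφ : ∀ I, I ⊆ M.E →
    (M.Indep I ↔ LinearIndependent (ZMod 2) (fun x : I => φ x.1)))
    {K : Set α} (hK : Cocircuit M K) {p : α} (hp : p ∈ K) {R : Set α} (hR : IsTriangle M R)
    (hpR : p ∈ R) : ∃ t s, t ∈ K ∧ s ∉ K ∧ t ≠ p ∧ R = {p, t, s} ∧ φ p + φ t + φ s = 0 ∧
      t ∈ M.E ∧ s ∈ M.E := by
  obtain ⟨q, r, hT, hpq, hpr, hqr, h0, hpE, hqE, hrE⟩ := tri_sum hφ hR hpR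
  have := parity hφ hK hpE hqE hrE h0 hp
  by_cases hq : q ∈ K
  · exact ⟨q, r, hq, this.1 hq, hpq.symm, hT, h0, hqE, hrE⟩
  · refine ⟨r, q, by tauto, hq, hpr.symm, ?_, ?_, hrE, hqE⟩
    · rw [hT, Set.pair_comm]
    · rw [← h0]; abel

lemma no_triad (hφ : ∀ I, I ⊆ M.E →
    (M.Indep I ↔ LinearIndependent (ZMod 2) (fun x : I => φ x.1)))
    (hs : ∀ u ∈ M.E, ∀ v ∈ M.E, u ≠ v → M.Indep {u, v})
    (h3 : EveryElementInThreeTriangles M) {T : Set α} (hT : IsTriad M T) : False := by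
  obtain ⟨hK, hc⟩ := hT
  obtain ⟨a, b, c, hab, hac, hbc, rfl⟩ := Set.encard_eq_three.1 hc
  have haE : a ∈ M.E := hK.1 (by simp)
  obtain ⟨R1, R2, R3, h12, h13, h23, hR⟩ := Set.encard_eq_three.1 (h3 a haE)
  have hmem : ∀ R, R ∈ ({R1, R2, R3} : Set (Set α)) → IsTriangle M R ∧ a ∈ R := by
    intro R h; rw [← hR] at h; exact h
  have ha : a ∈ ({a, b, c} : Set α) := by simp
  obtain ⟨g1, g1'⟩ := hmem R1 (by simp)
  obtain ⟨g2, g2'⟩ := hmem R2 (by simp)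
  obtain ⟨g3, g3'⟩ := hmem R3 (by simp)
  obtain ⟨t1, s1, m1, -, n1, e1, f1, -, E1⟩ := tri_coc hφ hK ha g1 g1'
  obtain ⟨t2, s2, m2, -, n2, e2, f2, -, E2⟩ := tri_coc hφ hK ha g2 g2'
  obtain ⟨t3, s3, m3, -, n3, e3, f3, -, E3⟩ := tri_coc hφ hK ha g3 g3'
  have key : ∀ {t s t' s'}, φ a + φ t + φ s = 0 → φ a + φ t' + φ s' = 0 → s ∈ M.E → s' ∈ M.E →
      t = t' → ({a, t, s} : Set α) = {a, t', s'} := by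
    intro t s t' s' h h' hs1 hs2 ht
    subst ht
    have : s = s' := phi_inj hφ hs hs1 hs2 (by rw [third h, third h'])
    rw [this]
  have k12 := key f1 f2 E1 E2
  have k13 := key f1 f3 E1 E3
  have k23 := key f2 f3 E2 E3
  rw [← e1, ← e2] at k12
  rw [← e1, ← e3] at k13
  rw [← e2, ← e3] at k23
  simp only [mem_insert_iff, mem_singleton_iff] at m1 m2 m3
  grind

lemma compl4 (h : InternallyFourConnected M) (hE : (14 : ℕ∞) ≤ M.E.encard)
    (hnt : ∀ T, ¬ IsTriad M T)
    {F : Set α} (hF : F ⊆ M.E) (hlt : M.eRk F < M.eRank) : 4 ≤ (M.E \ F).encard := by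
  by_contra hc
  have hf := rank_fin h.1 hE
  have hne : (M.E \ F).encard ≠ ⊤ := by
    intro h; simp [h] at hc
  obtain ⟨n, hn⟩ := ENat.ne_top_iff_exists.1 hne
  have hn4 : n < 4 := by
    rw [← hn] at hc; norm_cast at hc; omega
  have hb : 4 ≤ F.encard := by
    have := compl_big hE (X := M.E \ F) sdiff_subset (by
      rw [← hn]; norm_cast; omega)
    rwa [sdiff_sdiff_cancel_left hF] at this
  have hre := M.eRk_le_encard (M.E \ F)
  rw [← hn] at hre
  obtain ⟨ρ, hρ⟩ := exists_rho M hf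
  have hlt' := hlt
  rw [← Matroid.eRk_ground, hρ, hρ] at hlt'
  rw [hρ] at hre
  norm_cast at hlt' hre
  rcases Nat.eq_zero_or_pos n with h0 | hpos
  · subst h0
    have : M.E \ F = ∅ := by rw [← Set.encard_eq_zero, ← hn]; rfl
    have : F = M.E := hF.antisymm (sdiff_eq_empty.1 this)
    rw [this] at hlt'; omega
  have c12 : ∀ k : ℕ, 1 ≤ k → k < 3 → k ≤ n → ρ M.E + k ≤ ρ F + ρ (M.E \ F) := by
    intro k h1 h2 h3
    have := conn h.1 hf k h1 h2 F hF (le_trans (by norm_cast; omega) hb) (by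
      rw [← hn]; exact_mod_cast h3)
    rw [← Matroid.eRk_ground, hρ, hρ, hρ] at this
    exact_mod_cast this
  by_cases hn2 : n < 3
  · have := c12 n hpos hn2 le_rfl
    omega
  have hn3 : n = 3 := by omega
  subst hn3
  have h2 := c12 2 (by norm_num) (by norm_num) (by norm_num)
  have := h.2 F (M.E \ F) (kSep_of M 3 F hF (by
      rw [← Matroid.eRk_ground, hρ, hρ, hρ]; norm_cast; omega)
    (le_trans (by norm_num) hb) (by rw [← hn]))
  rcases this with h | h | h | h
  · have := h.2; rw [this] at hb; exact absurd hb (by decide)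
  · exact hnt _ h
  · have : ¬ M.Indep (M.E \ F) := h.1.2.1
    apply this
    rw [Matroid.indep_iff_eRk_eq_encard_of_finite (Set.finite_of_encard_eq_coe hn.symm), ← hn, hρ]
    norm_cast; omega
  · exact hnt _ h

lemma keyM (h : InternallyFourConnected M) (hE : (14 : ℕ∞) ≤ M.E.encard)
    (hnt : ∀ T, ¬ IsTriad M T) {K : Set α} (hK : Cocircuit M K) {x : α} (hx : x ∈ K)
    {A B : Set α} (hA : M.closure A = A) (hB : M.closure B = B) (hAB : M.E ⊆ A ∪ B)
    (hKA : K ⊆ A) (hxB : x ∈ B) (hrA : M.eRk A < M.eRank) (hrB : M.eRk B < M.eRank)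
    (hr : M.eRk A + M.eRk B ≤ M.eRank + 3) : False := by
  have hf := rank_fin h.1 hE
  have hAE : A ⊆ M.E := hA ▸ M.closure_subset_ground A
  have hBE : B ⊆ M.E := hB ▸ M.closure_subset_ground B
  have hsub : M.E \ A ⊆ B := fun y hy => (hAB hy.1).resolve_left hy.2
  have hsub' : M.E \ B ⊆ A := fun y hy => (hAB hy.1).resolve_right hy.2
  have h1 := conn3 h hf A hAE ((compl4 h hE hnt hBE hrB).trans (Set.encard_le_encard hsub'))
    (compl4 h hE hnt hAE hrA)
  have h2 : x ∉ M.closure (M.E \ A) := fun hc =>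
    coc_notin hK hx (M.closure_subset_closure (sdiff_subset_sdiff_right hKA) hc)
  have h3 := Matroid.eRk_insert_eq_add_one (M := M) (e := x) (X := M.E \ A) ⟨hAE (hKA hx), h2⟩
  have h4 := M.eRk_mono (insert_subset hxB hsub)
  obtain ⟨ρ, hρ⟩ := exists_rho M hf
  rw [← Matroid.eRk_ground] at *
  simp only [hρ] at *
  norm_cast at *
  omega

lemma comb (hφ : ∀ I, I ⊆ M.E →
    (M.Indep I ↔ LinearIndependent (ZMod 2) (fun x : I => φ x.1)))
    (hs : ∀ u ∈ M.E, ∀ v ∈ M.E, u ≠ v → M.Indep {u, v})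
    (h3 : EveryElementInThreeTriangles M) {e : α} (he : e ∈ M.E) {C : Set α}
    (hC : Cocircuit M C)
    (hC' : ∀ z, z ∈ C ↔ z ≠ e ∧ ∃ T, IsTriangle M T ∧ e ∈ T ∧ z ∈ T)
    {x : α} (hx : x ∈ C)
    {A B : Set α} (hA : M.closure A = A) (hB : M.closure B = B) (hAB : M.E ⊆ A ∪ B)
    (hxA : x ∈ A) (hxB : x ∈ B) : C ⊆ A ∨ C ⊆ B := by
  have heC : e ∉ C := fun h => ((hC' e).1 h).1 rfl
  have hCE : C ⊆ M.E := hC.1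
  have inj : ∀ {u v}, u ∈ M.E → v ∈ M.E → φ u = φ v → u = v := fun hu hv h =>
    phi_inj hφ hs hu hv h
  have hbar : ∀ c ∈ C, ∃ c', c' ∈ C ∧ IsTriangle M {e, c, c'} ∧ φ e + φ c + φ c' = 0 := by
    intro c hc
    obtain ⟨hce, T, hT, heT, hcT⟩ := (hC' c).1 hc
    obtain ⟨t, s, htC, hsC, htc, hTe, h0, htE, hsE⟩ := tri_coc hφ hC hc hT hcT
    have hes : s = e := by
      rw [hTe] at heT
      rcases heT with h | h | h
      · exact absurd h.symm hce
      · exact absurd (h ▸ htC) heC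
      · exact h.symm
    subst hes
    refine ⟨t, htC, ?_, by rw [← h0]; abel⟩
    convert hT using 1
    rw [hTe]; ext; simp; tauto
  choose! b hbC hbT hb0 using hbar
  have nbr : ∀ c ∈ C, ∃ p q r s, p ∈ C ∧ q ∈ C ∧ r ∈ M.E ∧ s ∈ M.E ∧ φ c + φ p + φ r = 0 ∧
      φ c + φ q + φ s = 0 ∧ p ≠ c ∧ q ≠ c ∧ p ≠ b c ∧ q ≠ b c ∧ p ≠ q ∧ q ≠ b p := by
    intro c hc
    obtain ⟨S1, S2, S3, h12, h13, h23, hS⟩ := Set.encard_eq_three.1 (h3 c (hCE hc))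
    have hmem : ∀ R, R ∈ ({S1, S2, S3} : Set (Set α)) ↔ IsTriangle M R ∧ c ∈ R := by
      intro R; rw [← hS]; rfl
    have h0 := (hmem {e, c, b c}).2 ⟨hbT c hc, by simp⟩
    have : ∃ R1 R2, IsTriangle M R1 ∧ c ∈ R1 ∧ IsTriangle M R2 ∧ c ∈ R2 ∧ R1 ≠ R2 ∧
        R1 ≠ {e, c, b c} ∧ R2 ≠ {e, c, b c} := by
      have m1 := (hmem S1).1 (by simp)
      have m2 := (hmem S2).1 (by simp)
      have m3 := (hmem S3).1 (by simp)
      rcases h0 with h | h | h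
      · exact ⟨S2, S3, m2.1, m2.2, m3.1, m3.2, h23, h ▸ h12.symm, h ▸ h13.symm⟩
      · exact ⟨S1, S3, m1.1, m1.2, m3.1, m3.2, h13, h ▸ h12, h ▸ h23.symm⟩
      · exact ⟨S1, S2, m1.1, m1.2, m2.1, m2.2, h12, h ▸ h13, h ▸ h23⟩
    obtain ⟨R1, R2, t1, c1, t2, c2, hne, hn1, hn2⟩ := this
    obtain ⟨p, r, hpC, hrC, hpc, hR1, s1, hpE, hrE⟩ := tri_coc hφ hC hc t1 c1
    obtain ⟨q, s, hqC, hsC, hqc, hR2, s2, hqE, hsE⟩ := tri_coc hφ hC hc t2 c2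
    have hbc : ∀ {R : Set α} {p r}, R = {c, p, r} → φ c + φ p + φ r = 0 → r ∈ M.E →
        R ≠ {e, c, b c} → p ≠ b c := by
      intro R p r hR hsum hrE hne hp
      apply hne
      subst hp
      have : r = e := inj hrE he (by
        rw [third hsum]; exact (third (show φ c + φ (b c) + φ e = 0 by rw [← hb0 c hc]; abel)).symm)
      rw [hR, this]; ext; simp; tauto
    refine ⟨p, q, r, s, hpC, hqC, hrE, hsE, s1, s2, hpc, hqc, hbc hR1 s1 hrE hn1,
      hbc hR2 s2 hsE hn2, ?_, ?_⟩
    · intro hpq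
      subst hpq
      apply hne
      rw [hR1, hR2, inj hrE hsE (by rw [third s1, third s2])]
    · intro hq
      have hsum : φ e + φ r + φ s = 0 := by
        have h1 := hb0 p hpC
        rw [← hq] at h1
        linear_combination (norm := module) s1 + s2 + h1 - dbl (φ c) - dbl (φ p) - dbl (φ q)
      have her : e ≠ r := by
        intro her
        subst her
        have : s ≠ s := by
          intro _
          have : p = b c := inj hpE (hCE (hbC c hc)) (by
            rw [third (hb0 c hc)]
            exact third (show φ e + φ c + φ p = 0 by rw [← s1]; abel))
          exact hbc hR1 s1 hrE hn1 this
        exact this rfl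
      have hes : e ≠ s := by
        intro hes
        subst hes
        have : q = b c := inj hqE (hCE (hbC c hc)) (by
            rw [third (hb0 c hc)]
            exact third (show φ e + φ c + φ q = 0 by rw [← s2]; abel))
        exact hbc hR2 s2 hsE hn2 this
      have hrs : r ≠ s := by
        intro hrs
        subst hrs
        have : p = q := inj hpE hqE (by
          rw [third (show φ c + φ r + φ p = 0 by rw [← s1]; abel),
            third (show φ c + φ r + φ q = 0 by rw [← s2]; abel)])
        subst this
        exact hne (by rw [hR1, hR2])
      have htri := tri_of_sum hφ hs he hrE hsE her hes hrs hsum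
      exact hrC ((hC' r).2 ⟨her.symm, _, htri, by simp, by simp⟩)
  have six : ∀ c ∈ C, ∀ p ∈ C, ∀ q ∈ C, p ≠ c → p ≠ b c → q ≠ c → q ≠ b c → p ≠ q → q ≠ b p →
      ∀ z ∈ C, z = c ∨ z = b c ∨ z = p ∨ z = b p ∨ z = q ∨ z = b q := by
    intro c hc p hp q hq n1 n2 n3 n4 n5 n6 z hz
    have hpe : p ≠ e := fun h => heC (h ▸ hp)
    have hqe : q ≠ e := fun h => heC (h ▸ hq)
    have hsub : ({{e, c, b c}, {e, p, b p}, {e, q, b q}} : Set (Set α)) ⊆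
        {T | IsTriangle M T ∧ e ∈ T} := by
      rintro T (rfl | rfl | rfl)
      · exact ⟨hbT c hc, by simp⟩
      · exact ⟨hbT p hp, by simp⟩
      · exact ⟨hbT q hq, by simp⟩
    have d1 : ({e, c, b c} : Set α) ≠ {e, p, b p} := by
      intro h
      have : p ∈ ({e, c, b c} : Set α) := by rw [h]; simp
      simp [hpe, n1, n2] at this
    have d2 : ({e, c, b c} : Set α) ≠ {e, q, b q} := by
      intro h
      have : q ∈ ({e, c, b c} : Set α) := by rw [h]; simp
      simp [hqe, n3, n4] at this
    have d3 : ({e, p, b p} : Set α) ≠ {e, q, b q} := by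
      intro h
      have : q ∈ ({e, p, b p} : Set α) := by rw [h]; simp
      simp [hqe, n5.symm, n6] at this
    have hcard : ({{e, c, b c}, {e, p, b p}, {e, q, b q}} : Set (Set α)).encard = 3 :=
      Set.encard_eq_three.2 ⟨_, _, _, d1, d2, d3, rfl⟩
    have heq := Set.Finite.eq_of_subset_of_encard_le
      (Set.finite_of_encard_eq_coe hcard) hsub (by rw [hcard, h3 e he])
    obtain ⟨hze, T, hT, heT, hzT⟩ := (hC' z).1 hz
    have : T ∈ ({{e, c, b c}, {e, p, b p}, {e, q, b q}} : Set (Set α)) := by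
      rw [heq]; exact ⟨hT, heT⟩
    rcases this with rfl | rfl | rfl <;> simp [hze] at hzT <;> tauto
  obtain ⟨p, q, r, s, hp, hq, hr, hs', s1, s2, n1, n2, n3, n4, n5, n6⟩ := nbr x hx
  have six' := six x hx p hp q hq n1 n3 n2 n4 n5 n6
  have hf : ∃ z f, (z = q ∨ z = b q) ∧ f ∈ M.E ∧ φ p + φ z + φ f = 0 := by
    obtain ⟨p', q', r', s', hp', hq', hr', hs'', s1', s2', n1', n2', n3', n4', n5', n6'⟩ := nbr p hp
    have e1 := six' p' hp'
    have e2 := six' q' hq'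
    by_cases c1 : p' = q ∨ p' = b q
    · exact ⟨p', r', c1, hr', s1'⟩
    by_cases c2 : q' = q ∨ q' = b q
    · exact ⟨q', s', c2, hs'', s2'⟩
    exfalso
    have hbb : b (b x) = x := inj (hCE (hbC _ (hbC x hx))) (hCE hx) (by
      rw [third (hb0 _ (hbC x hx))]
      exact (third (show φ e + φ (b x) + φ x = 0 by rw [← hb0 x hx]; abel)).symm)
    grind
  obtain ⟨z, f, hz, hf, hpf⟩ := hf
  have hbx := hb0 x hx
  have hbp := hb0 p hp
  have hbq := hb0 q hq
  have fl : ∀ D : Set α, M.closure D = D → ∀ u v w, u ∈ M.E → v ∈ M.E → w ∈ M.E →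
      φ u + φ v + φ w = 0 → (u ∈ D → v ∈ D → w ∈ D) ∧ (u ∈ D → w ∈ D → v ∈ D) ∧
        (v ∈ D → w ∈ D → u ∈ D) := by
    intro D hD u v w hu hv hw h
    refine ⟨fun a b => flat_tri hφ hD a b hw h,
      fun a b => flat_tri hφ hD a b hv (by rw [← h]; abel),
      fun a b => flat_tri hφ hD a b hu (by rw [← h]; abel)⟩
  have xE := hCE hx
  have pE := hCE hp
  have qE := hCE hq
  have bxE := hCE (hbC x hx)
  have bpE := hCE (hbC p hp)
  have bqE := hCE (hbC q hq)
  have s1b : φ (b x) + φ (b p) + φ r = 0 := by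
    linear_combination (norm := module) s1 + hbx + hbp - dbl (φ x) - dbl (φ p) - dbl (φ e)
  have s2b : φ (b x) + φ (b q) + φ s = 0 := by
    linear_combination (norm := module) s2 + hbx + hbq - dbl (φ x) - dbl (φ q) - dbl (φ e)
  have U : ∀ u ∈ M.E, u ∈ A ∨ u ∈ B := fun u hu => hAB hu
  have goalof : ∀ D : Set α, x ∈ D → b x ∈ D → p ∈ D → b p ∈ D → q ∈ D → b q ∈ D → C ⊆ D := by
    intro D _ _ _ _ _ _ y hy
    rcases six' y hy with h | h | h | h | h | h <;> rw [h] <;> assumption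
  have zE : z ∈ M.E := by rcases hz with h | h <;> rw [h] <;> assumption
  have gA := goalof A
  have gB := goalof B
  have A1 := fl A hA _ _ _ he xE bxE hbx
  have A2 := fl A hA _ _ _ he pE bpE hbp
  have A3 := fl A hA _ _ _ he qE bqE hbq
  have A4 := fl A hA _ _ _ xE pE hr s1
  have A5 := fl A hA _ _ _ xE qE hs' s2
  have A6 := fl A hA _ _ _ bxE bpE hr s1b
  have A7 := fl A hA _ _ _ bxE bqE hs' s2b
  have A8 := fl A hA _ _ _ pE zE hf hpf
  have B1 := fl B hB _ _ _ he xE bxE hbx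
  have B2 := fl B hB _ _ _ he pE bpE hbp
  have B3 := fl B hB _ _ _ he qE bqE hbq
  have B4 := fl B hB _ _ _ xE pE hr s1
  have B5 := fl B hB _ _ _ xE qE hs' s2
  have B6 := fl B hB _ _ _ bxE bpE hr s1b
  have B7 := fl B hB _ _ _ bxE bqE hs' s2b
  have B8 := fl B hB _ _ _ pE zE hf hpf
  have u1 := U e he
  have u2 := U p pE
  have u3 := U q qE
  have u4 := U (b p) bpE
  have u5 := U (b q) bqE
  have u6 := U f hf
  have hzA : z ∈ A → q ∈ A ∨ b q ∈ A := fun h =>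
    hz.elim (fun e => Or.inl (e ▸ h)) (fun e => Or.inr (e ▸ h))
  have hzB : z ∈ B → q ∈ B ∨ b q ∈ B := fun h =>
    hz.elim (fun e => Or.inl (e ▸ h)) (fun e => Or.inr (e ▸ h))
  have hzA' : q ∈ A → b q ∈ A → z ∈ A := fun h h' =>
    hz.elim (fun e => e ▸ h) (fun e => e ▸ h')
  have hzB' : q ∈ B → b q ∈ B → z ∈ B := fun h h' =>
    hz.elim (fun e => e ▸ h) (fun e => e ▸ h')
  exact prop_aux hxA hxB gA gB A1 A2 A3 A4 A5 A6 A7 A8 B1 B2 B3 B4 B5 B6 B7 B8 u1 u2 u3 u4 u5 u6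
    hzA hzB hzA' hzB'

end rep2
lemma ssub_three {U D : Set α} (hU : U.encard = 3) (hD : D ⊂ U) : D.encard ≤ 2 := by
  have hfin : U.Finite := Set.finite_of_encard_eq_coe hU
  have h := (hfin.subset hD.subset).encard_lt_encard hD
  rw [hU] at h
  exact Order.le_of_lt_add_one (lt_of_lt_of_eq h (by norm_num))

lemma final_tri {N : Matroid α} (h : NConnected N 3) (hf : N.eRank ≠ ⊤)
    (hs : ∀ u ∈ N.E, ∀ v ∈ N.E, N.Indep {u, v})
    {U V : Set α} (hsep : IsKSeparation N 3 U V) (hU : U.encard = 3) :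
    IsTriangle N U ∨ IsTriad N U := by
  obtain ⟨hdis, hun, hr, -, hV⟩ := hsep
  have hUE : U ⊆ N.E := hun ▸ subset_union_left
  have hVE : V ⊆ N.E := hun ▸ subset_union_right
  have hfin : U.Finite := Set.finite_of_encard_eq_coe hU
  have hVc : V = N.E \ U := by
    rw [← hun, union_sdiff_left, hdis.symm.sdiff_eq_left]
  obtain ⟨ρ, hρ⟩ := exists_rho N hf
  rw [eRank_eq, eRank_eq, eRk_eq, ← Matroid.eRk_ground, hρ, hρ, hρ] at hr
  norm_cast at hr
  by_cases hi : N.Indep U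
  · right
    have hU3 : ρ U = 3 := by
      have := hi.eRk_eq_encard
      rw [hρ, hU] at this; exact_mod_cast this
    refine ⟨⟨hUE, ?_, ?_⟩, hU⟩
    · change ¬ N.Coindep U
      rw [Matroid.coindep_iff_compl_spanning hUE, ← hVc]
      intro hsp
      have := hsp.eRk_eq
      rw [← Matroid.eRk_ground, hρ, hρ] at this
      norm_cast at this
      omega
    · intro D hD
      change N.Coindep D
      have hDE := hD.subset.trans hUE
      have hDfin := hfin.subset hD.subset
      by_contra hc
      have hne : D.Nonempty := by
        rw [nonempty_iff_ne_empty]; rintro rfl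
        exact hc N✶.empty_indep
      have hlt : ρ (N.E \ D) < ρ N.E := by
        by_contra hlt
        apply hc
        haveI : N.RankFinite := N.eRank_ne_top_iff.1 hf
        rw [Matroid.coindep_iff_compl_spanning hDE, Matroid.spanning_iff_eRk_le sdiff_subset,
          ← Matroid.eRk_ground, hρ, hρ]
        norm_cast; omega
      have h2 := ssub_three hU hD
      obtain ⟨n, hn⟩ := ENat.ne_top_iff_exists.1 (Set.encard_ne_top_iff.2 hDfin)
      have hn1 : 1 ≤ n := by
        have := Set.one_le_encard_iff_nonempty.2 hne
        rw [← hn] at this; exact_mod_cast this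
      rw [← hn] at h2
      have h2' : n ≤ 2 := by exact_mod_cast h2
      have hVD : V ⊆ N.E \ D := fun y hy => ⟨hVE hy, fun hyD => hdis.le_bot ⟨hD.subset hyD, hy⟩⟩
      have := conn h hf n hn1 (by omega) D hDE hn.le
        (le_trans (by norm_cast; omega) (hV.trans (Set.encard_le_encard hVD)))
      have h4 := N.eRk_le_encard D
      rw [← hn, hρ] at h4
      rw [← Matroid.eRk_ground, hρ, hρ, hρ] at this
      norm_cast at this h4
      omega
  · left
    refine ⟨⟨hUE, hi, ?_⟩, hU⟩
    intro D hD
    have h2 := ssub_three hU hD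
    have hDE := hD.subset.trans hUE
    rcases D.eq_empty_or_nonempty with rfl | ⟨u, hu⟩
    · exact N.empty_indep
    by_cases hsub : D ⊆ {u}
    · exact (hs u (hDE hu) u (hDE hu)).subset (by simpa using hsub)
    obtain ⟨v, hv, hvu⟩ := not_subset.1 hsub
    have hne : u ≠ v := fun h => hvu (by simp [h])
    have : ({u, v} : Set α) = D := by
      apply Set.Finite.eq_of_subset_of_encard_le (by simp)
      · simp [insert_subset_iff, hu, hv]
      · rw [Set.encard_pair hne]; exact h2
    rw [← this]
    exact hs u (hDE hu) v (hDE hv)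

lemma four_of {U : Set α} (h : 3 ≤ U.encard) (h3 : U.encard ≠ 3) : 4 ≤ U.encard := by
  have := Order.add_one_le_of_lt (lt_of_le_of_ne h h3.symm)
  exact le_trans (by norm_num) this

lemma mem_span3 {a b c d : α →₀ ZMod 2}
    (h : d ∈ Submodule.span (ZMod 2) ({a, b, c} : Set (α →₀ ZMod 2))) :
    ∃ x y z : ZMod 2, d = x • a + y • b + z • c := by
  obtain ⟨x, y, z, h⟩ := Submodule.mem_span_triple.1 h
  exact ⟨x, y, z, h.symm⟩

lemma rank4 {M : Matroid α} {φ : α → (α →₀ ZMod 2)} (hφ : ∀ I, I ⊆ M.E →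
    (M.Indep I ↔ LinearIndependent (ZMod 2) (fun x : I => φ x.1)))
    {x : α} {S U : Set α} (hx : x ∈ M.E) (hS : S ⊆ M.E) (hxS : x ∉ S) (hU : U ⊆ S)
    (hs : ∀ s ∈ S, ∀ t ∈ S, M.Indep {x, s, t}) (h4 : 4 ≤ U.encard) :
    4 ≤ M.eRk (insert x U) := by
  obtain ⟨Y, hYU, hY⟩ := Set.exists_subset_encard_eq h4
  obtain ⟨u, hu⟩ : Y.Nonempty := by
    rw [← Set.encard_ne_zero, hY]; norm_num
  have h1 : (Y \ {u}).encard = 3 := by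
    have := Set.encard_sdiff_singleton_add_one hu
    rw [hY] at this
    have hne : (Y \ {u}).encard ≠ ⊤ := by
      intro h
      rw [h] at this
      simp at this
    obtain ⟨m, hm⟩ := ENat.ne_top_iff_exists.1 hne
    rw [← hm] at this ⊢
    norm_cast at this ⊢
    omega
  obtain ⟨a, b, c, hab, hac, hbc, heq⟩ := Set.encard_eq_three.1 h1
  have ha : a ∈ Y \ {u} := by rw [heq]; simp
  have hb : b ∈ Y \ {u} := by rw [heq]; simp
  have hc : c ∈ Y \ {u} := by rw [heq]; simp
  have au : a ≠ u := fun h => ha.2 (by simp [h])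
  have bu : b ≠ u := fun h => hb.2 (by simp [h])
  have cu : c ≠ u := fun h => hc.2 (by simp [h])
  replace ha := hYU ha.1
  replace hb := hYU hb.1
  replace hc := hYU hc.1
  replace hu := hYU hu
  have E : ∀ {y}, y ∈ U → y ∈ M.E := fun h => hS (hU h)
  have nx : ∀ {y}, y ∈ U → y ≠ x := fun h h' => hxS (h' ▸ hU h)
  -- three elements
  have tri : ∀ {s t y}, s ∈ U → t ∈ U → y ∈ U → s ≠ t → s ≠ y → t ≠ y →
      M.eRk (insert x U) < 4 → φ y = φ s + φ t ∨ φ y = φ x + φ s + φ t := by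
    intro s t y hs' ht hy hst hsy hty hlt
    have hi := hs s (hU hs') t (hU ht)
    have hcl : y ∈ M.closure {x, s, t} := by
      rw [hi.mem_closure_iff']
      refine ⟨E hy, fun hi4 => ?_⟩
      exfalso
      have h5 := hi4.encard_le_eRk_of_subset (X := insert x U)
        (by simp [insert_subset_iff, hs', ht, hy])
      have h6 : (insert y ({x, s, t} : Set α)).encard = 4 := by
        rw [Set.encard_insert_of_notMem (by simp [nx hy, hsy.symm, hty.symm]),
          Set.encard_eq_three.2 ⟨x, s, t, (nx hs').symm, (nx ht).symm, hst, rfl⟩]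
        norm_num
      rw [h6] at h5
      exact absurd hlt (not_lt.2 h5)
    have no : ∀ {v}, v ∈ U → v ≠ y → φ y ∉ Submodule.span (ZMod 2) (φ '' {x, v}) := by
      intro v hv hvy hmem
      rw [← mem_cl hφ (by simp [insert_subset_iff, hx, E hv]) (E hy)] at hmem
      have hi' := hs v (hU hv) y (hU hy)
      refine (hi'.notMem_closure_sdiff_of_mem (e := y) (by simp)) (M.closure_subset_closure ?_ hmem)
      simp [insert_subset_iff, hvy, (nx hy).symm]
    rw [mem_cl hφ (by simp [insert_subset_iff, hx, E hs', E ht]) (E hy)] at hcl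
    rw [image_insert_eq, image_pair] at hcl
    obtain ⟨i, j, k, hijk⟩ := mem_span3 hcl
    have h01 : ∀ c : ZMod 2, c = 0 ∨ c = 1 := by decide
    rcases h01 j with rfl | rfl
    · exfalso
      refine no ht hty.symm.symm ?_
      rw [image_pair, Submodule.mem_span_pair]
      exact ⟨i, k, by rw [hijk]; simp⟩
    rcases h01 k with rfl | rfl
    · exfalso
      refine no hs' hsy ?_
      rw [image_pair, Submodule.mem_span_pair]
      exact ⟨i, 1, by rw [hijk]; simp⟩
    rcases h01 i with rfl | rfl
    · left; rw [hijk]; simp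
    · right; rw [hijk]; simp
  by_contra hlt
  rw [not_le] at hlt
  have t1 := tri ha hb hc hab hac hbc hlt
  have t2 := tri ha hb hu hab au bu hlt
  have hi := hs c (hU hc) u (hU hu)
  have : φ c ∈ Submodule.span (ZMod 2) (φ '' {x, u}) := by
    have : φ c = φ u ∨ φ c = φ x + φ u := by
      have d := dbl (φ x)
      rcases t1 with t1 | t1 <;> rcases t2 with t2 | t2 <;> rw [t1, t2]
      · left; rfl
      · right; linear_combination (norm := module) - d
      · right; module
      · left; rfl
    rcases this with h | h
    · rw [h]; exact Submodule.subset_span (by simp)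
    · rw [h]; exact add_mem (Submodule.subset_span (by simp)) (Submodule.subset_span (by simp))
  rw [← mem_cl hφ (by simp [insert_subset_iff, hx, E hu]) (E hc)] at this
  refine (hi.notMem_closure_sdiff_of_mem (e := c) (by simp)) (M.closure_subset_closure ?_ this)
  simp [insert_subset_iff, cu.symm, (nx hc).symm]

theorem stmt6 (M : Matroid α) (hI4 : InternallyFourConnected M) (hB : Binary M)
    (h3 : EveryElementInThreeTriangles M) (hE : (14 : ℕ∞) ≤ M.E.encard)
    (e : α) (he : e ∈ M.E) (T₁ T₂ T₃ : Set α)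
    (hT : {T : Set α | IsTriangle M T ∧ e ∈ T} = {T₁, T₂, T₃})
    (hCstar : Cocircuit M ((T₁ ∪ T₂ ∪ T₃) \ {e})) :
    ∀ x ∈ (T₁ ∪ T₂ ∪ T₃) \ {e}, SiContractI4C M x := by
  intro x hx N hN
  obtain ⟨φ, hφ⟩ := hB
  have hs : ∀ u ∈ M.E, ∀ v ∈ M.E, u ≠ v → M.Indep {u, v} := fun u hu v hv h =>
    simple hI4.1 hE hu hv h
  have hf := rank_fin hI4.1 hE
  have hnt : ∀ T, ¬ IsTriad M T := fun T hT => no_triad hφ hs h3 hT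
  have hC' : ∀ z, z ∈ (T₁ ∪ T₂ ∪ T₃) \ {e} ↔ z ≠ e ∧ ∃ T, IsTriangle M T ∧ e ∈ T ∧ z ∈ T := by
    intro z
    have hmem : ∀ T, (IsTriangle M T ∧ e ∈ T) ↔ T = T₁ ∨ T = T₂ ∨ T = T₃ := by
      intro T
      have : T ∈ {T : Set α | IsTriangle M T ∧ e ∈ T} ↔ T ∈ ({T₁, T₂, T₃} : Set (Set α)) := by
        rw [hT]
      simpa using this
    simp only [← and_assoc, hmem, mem_sdiff, mem_union, mem_singleton_iff]
    constructor
    · rintro ⟨(h | h) | h, hz⟩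
      exacts [⟨hz, T₁, by simp, h⟩, ⟨hz, T₂, by simp, h⟩, ⟨hz, T₃, by simp, h⟩]
    · rintro ⟨hz, T, rfl | rfl | rfl, h⟩ <;> tauto
  have hxE : x ∈ M.E := hCstar.1 hx
  set C := (T₁ ∪ T₂ ∪ T₃) \ {e} with hC
  have key : ∀ {A B : Set α}, M.closure A = A → M.closure B = B → M.E ⊆ A ∪ B → x ∈ A → x ∈ B →
      M.eRk A < M.eRank → M.eRk B < M.eRank → M.eRk A + M.eRk B ≤ M.eRank + 3 → False := by
    intro A B hA hB hAB hxA hxB h1 h2 h3'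
    rcases comb hφ hs h3 he hCstar hC' hx hA hB hAB hxA hxB with h | h
    · exact keyM hI4 hE hnt hCstar hx hA hB hAB h hxB h1 h2 h3'
    · exact keyM hI4 hE hnt hCstar hx hB hA (by rwa [union_comm]) h hxA h2 h1 (by rwa [add_comm])
  -- the simplification
  obtain ⟨S, hSE, rfl, hSn, hSu⟩ := hN
  change S ⊆ M.E \ {x} at hSE
  have hcon : contract M {x} = M ／ {x} := rfl
  rw [hcon] at hSn hSu ⊢
  have hxi : M.Indep {x} := by
    obtain ⟨y, hy, hyx⟩ : ∃ y ∈ M.E, y ≠ x := ⟨e, he, fun h => hx.2 (by simp [h])⟩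
    exact (hs x hxE y hy hyx.symm).subset (by simp)
  have hSM : S ⊆ M.E := fun y hy => (hSE hy).1
  have hxS : x ∉ S := fun h => (hSE h).2 rfl
  have hci : ∀ I, (M ／ {x}).Indep I ↔ x ∉ I ∧ M.Indep (insert x I) := by
    intro I
    rw [hxi.contract_indep_iff]
    simp
  have hcl : ∀ X, (M ／ {x}).closure X = M.closure (insert x X) \ {x} := by
    intro X; rw [Matroid.contract_closure_eq]; simp
  have hnl : ∀ f ∈ M.E, f ≠ x → Nonloop (M ／ {x}) f := by
    intro f hf hfx
    rw [Nonloop, hci]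
    exact ⟨by simpa using hfx.symm, hs x hxE f hf hfx.symm⟩
  have hcov : ∀ f ∈ M.E, f ≠ x → ∃ s ∈ S, f ∈ M.closure {x, s} := by
    intro f hf hfx
    obtain ⟨s, ⟨hsS, hsf⟩, -⟩ := hSu f (hnl f hf hfx)
    refine ⟨s, hsS, ?_⟩
    rw [hcl, hcl] at hsf
    have : f ∈ M.closure (insert x {f}) \ {x} := 
      ⟨M.mem_closure_of_mem (by simp) (by simp [insert_subset_iff, hxE, hf]), by simpa using hfx⟩
    rw [← hsf] at this
    exact this.1
  have hS2 : ∀ s ∈ S, ∀ t ∈ S, M.Indep {x, s, t} := by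
    intro s hsS t htS
    have hsx : s ≠ x := fun h => hxS (h ▸ hsS)
    have htx : t ≠ x := fun h => hxS (h ▸ htS)
    by_cases hst : s = t
    · subst hst; simpa using hs x hxE s (hSM hsS) hsx.symm
    by_contra hd
    have par : ∀ {s t}, s ∈ S → t ∈ S → ¬ M.Indep {x, s, t} →
        M.closure (insert x {t}) ⊆ M.closure (insert x {s}) := by
      intro s t hsS htS hd
      apply M.closure_subset_closure_of_subset_closure
      have hsx : s ≠ x := fun h => hxS (h ▸ hsS)
      intro y hy
      rcases hy with rfl | hy
      · exact M.mem_closure_of_mem (by simp) (by simp [insert_subset_iff, hxE, hSM hsS])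
      · rw [mem_singleton_iff] at hy; subst hy
        rw [(hs x hxE s (hSM hsS) hsx.symm).mem_closure_iff']
        refine ⟨hSM htS, fun h => absurd ?_ hd⟩
        convert h using 1
        ext; simp; tauto
    have hcc : (M ／ {x}).closure {s} = (M ／ {x}).closure {t} := by
      rw [hcl, hcl]
      rw [(par hsS htS hd).antisymm (par htS hsS (by rwa [Set.pair_comm]))]
    obtain ⟨w, -, huniq⟩ := hSu t (hnl t (hSM htS) htx)
    exact hst ((huniq s ⟨hsS, hcc⟩).trans (huniq t ⟨htS, rfl⟩).symm)
  set N := (M ／ {x}) ↾ S with hNdef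
  have hNE : N.E = S := rfl
  have hrk : ∀ U ⊆ S, N.eRk U + 1 = M.eRk (insert x U) := by
    intro U hU
    rw [hNdef, Matroid.restrict_eRk_eq _ hU]
    obtain ⟨I, hI⟩ := (M ／ {x}).exists_isBasis U (hU.trans hSE)
    have h1 := hxi.union_isBasis_union_of_contract_isBasis hI
    have hxI : x ∉ I := fun h => hxS (hU (hI.subset h))
    rw [hI.eRk_eq_encard, ← union_singleton, h1.eRk_eq_encard, union_singleton,
      Set.encard_insert_of_notMem hxI]
  have hspan : M.eRk (insert x S) = M.eRank := by
    rw [← M.eRk_closure_eq]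
    apply Matroid.eRk_eq_eRank
    intro f hf
    by_cases hfx : f = x
    · subst hfx; exact M.mem_closure_of_mem (by simp) (insert_subset hxE hSM)
    obtain ⟨s, hsS, hfs⟩ := hcov f hf hfx
    exact M.closure_subset_closure (by simp [insert_subset_iff, hsS]) hfs
  have hrN : N.eRank + 1 = M.eRank := by
    rw [← Matroid.eRk_ground, hNE, hrk S subset_rfl, hspan]
  have hfN : N.eRank ≠ ⊤ := by
    intro h; rw [h] at hrN; exact hf (by rw [← hrN]; simp)
  have key2 : ∀ k : ℕ, 1 ≤ k → k ≤ 3 → ∀ U V, IsKSeparation N k U V → (k : ℕ∞) ≤ N.eRk U →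
      (k : ℕ∞) ≤ N.eRk V → False := by
    intro k hk1 hk3 U V hsep hkU hkV
    obtain ⟨hdis, hun, hr, -, -⟩ := hsep
    rw [hNE] at hun
    have hUS : U ⊆ S := hun ▸ subset_union_left
    have hVS : V ⊆ S := hun ▸ subset_union_right
    have hU1 := hrk U hUS
    have hV1 := hrk V hVS
    rw [eRank_eq, eRank_eq, eRk_eq] at hr
    obtain ⟨ρ, hρ⟩ := exists_rho M hf
    obtain ⟨σ, hσ⟩ := exists_rho N hfN
    rw [← Matroid.eRk_ground, ← Matroid.eRk_ground, hσ, hρ] at hrN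
    rw [← Matroid.eRk_ground, hσ, hσ, hσ] at hr
    rw [hσ, hρ] at hU1 hV1
    rw [hσ] at hkU hkV
    norm_cast at hrN hr hU1 hV1 hkU hkV
    have hin : ∀ {W}, W ⊆ S → insert x W ⊆ M.E := fun h => insert_subset hxE (h.trans hSM)
    refine key (A := M.closure (insert x U)) (B := M.closure (insert x V))
      (M.closure_closure _) (M.closure_closure _) ?_
      (M.mem_closure_of_mem (by simp) (hin hUS)) (M.mem_closure_of_mem (by simp) (hin hVS)) ?_ ?_ ?_
    · intro f hf
      by_cases hfx : f = x
      · subst hfx; exact Or.inl (M.mem_closure_of_mem (by simp) (hin hUS))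
      obtain ⟨s, hsS, hfs⟩ := hcov f hf hfx
      rw [← hun] at hsS
      rcases hsS with h | h
      · exact Or.inl (M.closure_subset_closure (by simp [insert_subset_iff, h]) hfs)
      · exact Or.inr (M.closure_subset_closure (by simp [insert_subset_iff, h]) hfs)
    · rw [M.eRk_closure_eq, ← Matroid.eRk_ground, hρ, hρ]; norm_cast; omega
    · rw [M.eRk_closure_eq, ← Matroid.eRk_ground, hρ, hρ]; norm_cast; omega
    · rw [M.eRk_closure_eq, M.eRk_closure_eq, ← Matroid.eRk_ground, hρ, hρ, hρ]; norm_cast; omega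
  have hpair : ∀ u ∈ N.E, ∀ v ∈ N.E, N.Indep {u, v} := by
    intro u hu v hv
    rw [hNE] at hu hv
    rw [hNdef, Matroid.restrict_indep_iff, hci]
    refine ⟨⟨?_, hS2 u hu v hv⟩, by simp [insert_subset_iff, hu, hv]⟩
    rintro (rfl | h)
    · exact hxS hu
    · rw [mem_singleton_iff] at h; subst h; exact hxS hv
  have hlow : ∀ k : ℕ, 1 ≤ k → k < 3 → ∀ U ⊆ S, (k : ℕ∞) ≤ U.encard → (k : ℕ∞) ≤ N.eRk U := by
    intro k h1 h2 U hU hk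
    obtain ⟨Y, hYU, hY⟩ := Set.exists_subset_encard_eq hk
    have : N.Indep Y := by
      have : k = 1 ∨ k = 2 := by omega
      rcases this with rfl | rfl
      · obtain ⟨a, rfl⟩ := Set.encard_eq_one.1 (by simpa using hY)
        have := hU (hYU (mem_singleton a))
        simpa using hpair a this a this
      · obtain ⟨a, b, hab, rfl⟩ := Set.encard_eq_two.1 (by simpa using hY)
        exact hpair a (hU (hYU (by simp))) b (hU (hYU (by simp)))
    rw [← hY]
    exact this.encard_le_eRk_of_subset hYU
  have hN3 : NConnected N 3 := by
    intro k hk1 hk3 U V hsep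
    have hun := hsep.2.1
    rw [hNE] at hun
    exact key2 k hk1 hk3.le U V hsep
      (hlow k hk1 hk3 U (hun ▸ subset_union_left) hsep.2.2.2.1)
      (hlow k hk1 hk3 V (hun ▸ subset_union_right) hsep.2.2.2.2)
  refine ⟨hN3, ?_⟩
  intro U V hsep
  by_cases hU3 : U.encard = 3
  · have := final_tri hN3 hfN hpair hsep hU3
    tauto
  by_cases hV3 : V.encard = 3
  · have hsep' : IsKSeparation N 3 V U := by
      obtain ⟨a, b, c, d, f⟩ := hsep
      exact ⟨a.symm, by rwa [union_comm], by rwa [add_comm], f, d⟩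
    have := final_tri hN3 hfN hpair hsep' hV3
    tauto
  exfalso
  have hun := hsep.2.1
  rw [hNE] at hun
  have big : ∀ W ⊆ S, 3 ≤ W.encard → W.encard ≠ 3 → ((3 : ℕ) : ℕ∞) ≤ N.eRk W := by
    intro W hW h1 h2
    have := rank4 hφ hxE hSM hxS hW hS2 (four_of h1 h2)
    rw [← hrk W hW] at this
    obtain ⟨σ, hσ⟩ := exists_rho N hfN
    rw [hσ] at this ⊢
    norm_cast at this ⊢
    omega
  exact key2 3 (by norm_num) le_rfl U V hsep
    (big U (hun ▸ subset_union_left) (by simpa using hsep.2.2.2.1) hU3)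
    (big V (hun ▸ subset_union_right) (by simpa using hsep.2.2.2.2) hV3)

end Paper
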